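/- arXiv:2603.23658 — 8 statements merged into one kernel-verified Lean document; each statement's English description precedes it below -/
import Mathlib

section
/- Let H be a real symmetric positive semidefinite n×n matrix, g ∈ ℝⁿ, λ > 0, and set w⋆ = -(H + λI)⁻¹g. Then w⋆ minimizes the unregularized quadratic q(w) = gᵀw + (1/2)wᵀHw over the closed ball of radius ‖w⋆‖: for every w ∈ ℝⁿ with ‖w‖ ≤ ‖w⋆‖, one has q(w⋆) ≤ q(w). (Thus the Tikhonov-regularized solution solves the trust-region subproblem with radius ‖w⋆‖.) -/
open Matrix

/-- The unregularized quadratic `q(w) = gᵀw + (1/2)wᵀHw`. -/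
noncomputable def quadObj {n : ℕ} (H : Matrix (Fin n) (Fin n) ℝ) (g : Fin n → ℝ)
    (w : Fin n → ℝ) : ℝ :=
  g ⬝ᵥ w + (1 / 2) * (w ⬝ᵥ (H *ᵥ w))

/-- Adding a positive multiple of the identity to a matrix with nonnegative quadratic form
gives an invertible matrix. -/
theorem isUnit_add_smul_one_of_dotProduct_mulVec_nonneg {ι : Type*} [Fintype ι] [DecidableEq ι]
    {H : Matrix ι ι ℝ} (hpsd : ∀ w : ι → ℝ, 0 ≤ w ⬝ᵥ (H *ᵥ w)) {c : ℝ} (hc : 0 < c) :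
    IsUnit (H + c • (1 : Matrix ι ι ℝ)) := by
  rw [← Matrix.mulVec_injective_iff_isUnit]
  intro x y hxy
  have hker : (H + c • (1 : Matrix ι ι ℝ)) *ᵥ (x - y) = 0 := by
    rw [Matrix.mulVec_sub]
    exact sub_eq_zero.mpr hxy
  have hform := congrArg (fun u => (x - y) ⬝ᵥ u) hker
  simp only [Matrix.add_mulVec, Matrix.smul_mulVec, Matrix.one_mulVec, dotProduct_add,
    dotProduct_smul, smul_eq_mul, dotProduct_zero] at hform
  have hnonneg : 0 ≤ (x - y) ⬝ᵥ (x - y) := Finset.sum_nonneg fun i _ => mul_self_nonneg _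
  have hzero : (x - y) ⬝ᵥ (x - y) = 0 := by
    have := hpsd (x - y)
    nlinarith
  exact sub_eq_zero.mp (dotProduct_self_eq_zero.mp hzero)

/-- A point `v` with `(H + lam I) v = -g` minimizes the quadratic over the ball of radius `‖v‖`. -/
theorem quadObj_le_of_mulVec_add_smul_eq_neg {n : ℕ} {H : Matrix (Fin n) (Fin n) ℝ}
    {g v w : Fin n → ℝ} {lam : ℝ} (hH : H.IsSymm) (hpsd : ∀ w : Fin n → ℝ, 0 ≤ w ⬝ᵥ (H *ᵥ w))
    (hlam : 0 ≤ lam) (hv : H *ᵥ v + lam • v = -g) (hw : w ⬝ᵥ w ≤ v ⬝ᵥ v) :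
    quadObj H g v ≤ quadObj H g w := by
  obtain ⟨d, rfl⟩ : ∃ d, w = v + d := ⟨w - v, by simp⟩
  have hsymm : v ⬝ᵥ (H *ᵥ d) = d ⬝ᵥ (H *ᵥ v) := by
    rw [Matrix.dotProduct_mulVec, ← Matrix.mulVec_transpose, hH.eq, dotProduct_comm]
  have hgd := congrArg (fun u => d ⬝ᵥ u) hv
  simp only [dotProduct_add, dotProduct_smul, smul_eq_mul, dotProduct_neg] at hgd
  simp only [add_dotProduct, dotProduct_add] at hw
  simp only [quadObj, Matrix.mulVec_add, add_dotProduct, dotProduct_add]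
  have hdd : 0 ≤ d ⬝ᵥ d := Finset.sum_nonneg fun i _ => mul_self_nonneg _
  have hcross : 0 ≤ lam * -(d ⬝ᵥ v) :=
    mul_nonneg hlam (by linarith [dotProduct_comm v d])
  linarith [hpsd d, dotProduct_comm g d]

/-- With `H` symmetric positive semidefinite, `λ > 0`, and
`w⋆ = -(H + λI)⁻¹ g`, the point `w⋆` minimizes the unregularized quadratic `q` over the closed
Euclidean ball of radius `‖w⋆‖` (the Euclidean norm of `w` is `√(w ⬝ᵥ w)`). -/
theorem stmt1 {n : ℕ} (H : Matrix (Fin n) (Fin n) ℝ) (g : Fin n → ℝ) (lam : ℝ)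
    (hH : H.IsSymm) (hpsd : ∀ w : Fin n → ℝ, 0 ≤ w ⬝ᵥ (H *ᵥ w)) (hlam : 0 < lam) :
    ∀ w : Fin n → ℝ,
      Real.sqrt (w ⬝ᵥ w) ≤
        Real.sqrt ((-((H + lam • (1 : Matrix (Fin n) (Fin n) ℝ))⁻¹ *ᵥ g)) ⬝ᵥ
          (-((H + lam • (1 : Matrix (Fin n) (Fin n) ℝ))⁻¹ *ᵥ g))) →
      quadObj H g (-((H + lam • (1 : Matrix (Fin n) (Fin n) ℝ))⁻¹ *ᵥ g)) ≤ quadObj H g w := by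
  intro w hw
  have hnonneg (u : Fin n → ℝ) : 0 ≤ u ⬝ᵥ u := Finset.sum_nonneg fun i _ => mul_self_nonneg _
  refine quadObj_le_of_mulVec_add_smul_eq_neg hH hpsd hlam.le ?_
    ((Real.sqrt_le_sqrt_iff (hnonneg _)).mp hw)
  have hunit := isUnit_add_smul_one_of_dotProduct_mulVec_nonneg hpsd hlam
  have hsplit (u : Fin n → ℝ) :
      H *ᵥ u + lam • u = (H + lam • (1 : Matrix (Fin n) (Fin n) ℝ)) *ᵥ u := by
    rw [Matrix.add_mulVec, Matrix.smul_mulVec, Matrix.one_mulVec]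
  rw [hsplit, Matrix.mulVec_neg, Matrix.mulVec_mulVec,
    Matrix.mul_nonsing_inv _ ((Matrix.isUnit_iff_isUnit_det _).mp hunit), Matrix.one_mulVec]
end

section
/- Let J : ℝᵖ × ℝ^q → ℝ be twice continuously differentiable with ∇²_ww J(w, θ) ⪰ λ_w I for some λ_w > 0 and all (w, θ), let w⋆(θ) be the unique minimizer of w ↦ J(w, θ), and let J̃(θ) = J(w⋆(θ), θ) be the reduced objective. If J̃ is twice differentiable at θ, then its Hessian equals the Schur complement of the w-block of the full Hessian of J, evaluated at (w⋆(θ), θ): ∇²J̃(θ) = ∇²_θθ J - ∇²_θw J · (∇²_ww J)⁻¹ · ∇²_wθ J, all blocks evaluated at (w⋆(θ), θ). -/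
open scoped RealInnerProductSpace

open Asymptotics Filter Topology

section PartialGradient

variable {E F : Type*} [NormedAddCommGroup E] [InnerProductSpace ℝ E]
  [NormedAddCommGroup F] [InnerProductSpace ℝ F] {J : E × F → ℝ}

theorem gradient_fst_eq [CompleteSpace E] {w : E} {t : F} (hJ : DifferentiableAt ℝ J (w, t)) :
    gradient (fun w' => J (w', t)) w =
      (InnerProductSpace.toDual ℝ E).symm
        ((fderiv ℝ J (w, t)).comp (ContinuousLinearMap.inl ℝ E F)) := by
  have h : HasFDerivAt (fun w' => J (w', t))
      ((fderiv ℝ J (w, t)).comp (ContinuousLinearMap.inl ℝ E F)) w :=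
    HasFDerivAt.comp (f := fun w' => (w', t)) w hJ.hasFDerivAt (hasFDerivAt_prodMk_left w t)
  rw [gradient, h.fderiv]

theorem gradient_snd_eq [CompleteSpace F] {w : E} {t : F} (hJ : DifferentiableAt ℝ J (w, t)) :
    gradient (fun t' => J (w, t')) t =
      (InnerProductSpace.toDual ℝ F).symm
        ((fderiv ℝ J (w, t)).comp (ContinuousLinearMap.inr ℝ E F)) := by
  have h : HasFDerivAt (fun t' => J (w, t'))
      ((fderiv ℝ J (w, t)).comp (ContinuousLinearMap.inr ℝ E F)) t :=
    HasFDerivAt.comp (f := fun t' => (w, t')) t hJ.hasFDerivAt (hasFDerivAt_prodMk_right w t)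
  rw [gradient, h.fderiv]

theorem ContDiff.differentiable_gradient_fst [CompleteSpace E] (hJ : ContDiff ℝ 2 J) :
    Differentiable ℝ (fun x : E × F => gradient (fun w => J (w, x.2)) x.1) := by
  have hd : Differentiable ℝ (fderiv ℝ J) :=
    (hJ.fderiv_right (m := 1) (by norm_num)).differentiable (by norm_num)
  have h : (fun x : E × F => gradient (fun w => J (w, x.2)) x.1) = fun x =>
      (InnerProductSpace.toDual ℝ E).symm
        ((fderiv ℝ J x).comp (ContinuousLinearMap.inl ℝ E F)) :=
    funext fun x => gradient_fst_eq (hJ.differentiable (by norm_num) _)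
  rw [h]
  exact (InnerProductSpace.toDual ℝ E).symm.toContinuousLinearEquiv.differentiable.comp
    (hd.clm_comp (differentiable_const _))

theorem ContDiff.differentiable_gradient_snd [CompleteSpace F] (hJ : ContDiff ℝ 2 J) :
    Differentiable ℝ (fun x : E × F => gradient (fun t => J (x.1, t)) x.2) := by
  have hd : Differentiable ℝ (fderiv ℝ J) :=
    (hJ.fderiv_right (m := 1) (by norm_num)).differentiable (by norm_num)
  have h : (fun x : E × F => gradient (fun t => J (x.1, t)) x.2) = fun x =>
      (InnerProductSpace.toDual ℝ F).symm
        ((fderiv ℝ J x).comp (ContinuousLinearMap.inr ℝ E F)) :=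
    funext fun x => gradient_snd_eq (hJ.differentiable (by norm_num) _)
  rw [h]
  exact (InnerProductSpace.toDual ℝ F).symm.toContinuousLinearEquiv.differentiable.comp
    (hd.clm_comp (differentiable_const _))

/-- Envelope theorem: if the `w`-gradient vanishes along a differentiable `u`, the gradient of
`t ↦ J (u t, t)` is the partial gradient of `J` in its second argument. -/
theorem gradient_comp_eq_gradient_snd [CompleteSpace E] [CompleteSpace F] {u : F → E} {t : F}
    (hJ : DifferentiableAt ℝ J (u t, t)) (hu : DifferentiableAt ℝ u t)
    (h0 : gradient (fun w => J (w, t)) (u t) = 0) :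
    gradient (fun t' => J (u t', t')) t = gradient (fun t' => J (u t, t')) t := by
  rw [gradient_fst_eq hJ, LinearIsometryEquiv.map_eq_zero_iff] at h0
  have h : HasFDerivAt (fun t' => J (u t', t'))
      ((fderiv ℝ J (u t, t)).comp ((fderiv ℝ u t).prod (ContinuousLinearMap.id ℝ F))) t :=
    HasFDerivAt.comp (f := fun t' => (u t', t')) t hJ.hasFDerivAt
      (hu.hasFDerivAt.prodMk (hasFDerivAt_id t))
  rw [gradient_snd_eq hJ, gradient, h.fderiv]
  congr 1
  ext v
  have h1 : fderiv ℝ J (u t, t) (fderiv ℝ u t v, 0) = 0 := DFunLike.congr_fun h0 (fderiv ℝ u t v)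
  have h2 : ((fderiv ℝ u t v, v) : E × F) = (fderiv ℝ u t v, 0) + (0, v) := by simp
  change fderiv ℝ J (u t, t) (fderiv ℝ u t v, v) = fderiv ℝ J (u t, t) (0, v)
  rw [h2, map_add, h1, zero_add]

end PartialGradient

section StrongMonotone

variable {E F : Type*} [NormedAddCommGroup E] [InnerProductSpace ℝ E]
  [NormedAddCommGroup F] [NormedSpace ℝ F]

theorem mul_norm_le_norm_sub_of_coercive_fderiv {g : E → E} {c : ℝ}
    (hg : Differentiable ℝ g) (hc : ∀ w v, c * ‖v‖ ^ 2 ≤ ⟪v, fderiv ℝ g w v⟫) (a b : E) :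
    c * ‖a - b‖ ≤ ‖g a - g b‖ := by
  have hd (s : ℝ) : HasDerivAt (fun s : ℝ => ⟪a - b, g (b + s • (a - b))⟫)
      ⟪a - b, fderiv ℝ g (b + s • (a - b)) (a - b)⟫ s := by
    have h1 : HasDerivAt (fun s : ℝ => b + s • (a - b)) (a - b) s := by
      simpa using ((hasDerivAt_id s).smul_const (a - b)).const_add b
    have h2 := (hg (b + s • (a - b))).hasFDerivAt.comp_hasDerivAt s h1
    simpa using (hasDerivAt_const s (a - b)).inner ℝ h2
  have h := mul_sub_le_image_sub_of_le_deriv (fun s => (hd s).differentiableAt)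
    (fun s => (hd s).deriv ▸ hc (b + s • (a - b)) (a - b)) zero_le_one
  simp only [one_smul, zero_smul, add_zero, sub_zero, mul_one, add_sub_cancel,
    ← inner_sub_right] at h
  have h' := h.trans (real_inner_le_norm _ _)
  rcases (norm_nonneg (a - b)).eq_or_lt with h0 | h0
  · rw [← h0, mul_zero]
    exact norm_nonneg _
  · nlinarith

theorem ContinuousLinearMap.isUnit_of_coercive [FiniteDimensional ℝ E] {A : E →L[ℝ] E} {c : ℝ}
    (hc : 0 < c) (hA : ∀ v, c * ‖v‖ ^ 2 ≤ ⟪v, A v⟫) : IsUnit A := by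
  have : CompleteSpace E := FiniteDimensional.complete ℝ E
  have hinj : Function.Injective A := by
    refine (injective_iff_map_eq_zero A).2 fun v hv => ?_
    have h := hA v
    rw [hv, inner_zero_right] at h
    by_contra hne
    have : 0 < ‖v‖ := norm_pos_iff.2 hne
    have : 0 < c * ‖v‖ ^ 2 := by positivity
    linarith
  exact ContinuousLinearMap.isUnit_iff_bijective.2
    ⟨hinj, LinearMap.injective_iff_surjective (f := A.toLinearMap).1 hinj⟩

/-- A zero curve of a map that is strongly monotone in its first argument is differentiable, with
the derivative predicted by the implicit function theorem. -/
theorem hasFDerivAt_of_zero_of_coercive [FiniteDimensional ℝ E] {G : E × F → E} {c : ℝ}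
    (hc : 0 < c) (hG : Differentiable ℝ G)
    (hcoer : ∀ w t v, c * ‖v‖ ^ 2 ≤ ⟪v, fderiv ℝ (fun w' => G (w', t)) w v⟫)
    {u : F → E} (hu : ∀ t, G (u t, t) = 0) (t : F) :
    HasFDerivAt u
      (-(Ring.inverse (fderiv ℝ (fun w => G (w, t)) (u t)) ∘L
        fderiv ℝ (fun t' => G (u t, t')) t)) t := by
  set A := fderiv ℝ (fun w => G (w, t)) (u t) with hA
  set B := fderiv ℝ (fun t' => G (u t, t')) t with hB
  have hAunit : IsUnit A := ContinuousLinearMap.isUnit_of_coercive hc (hcoer (u t) t)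
  have hleft (v : E) : Ring.inverse A (A v) = v :=
    DFunLike.congr_fun (Ring.inverse_mul_cancel A hAunit) v
  have hG' := (hG (u t, t)).hasFDerivAt
  have hA' : A = (fderiv ℝ G (u t, t)).comp (ContinuousLinearMap.inl ℝ E F) :=
    (HasFDerivAt.comp (f := fun w => (w, t)) (u t) hG' (hasFDerivAt_prodMk_left _ _)).fderiv
  have hB' : HasFDerivAt (fun t' => G (u t, t'))
      ((fderiv ℝ G (u t, t)).comp (ContinuousLinearMap.inr ℝ E F)) t :=
    HasFDerivAt.comp (f := fun t' => (u t, t')) t hG' (hasFDerivAt_prodMk_right _ _)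
  have hO : (fun t' => u t' - u t) =O[𝓝 t] fun t' => t' - t := by
    refine IsBigO.trans (IsBigO.of_bound c⁻¹ (Eventually.of_forall fun t' => ?_))
      hB'.isBigO_sub
    have h := mul_norm_le_norm_sub_of_coercive_fderiv
      (hG.comp (differentiable_id.prodMk (differentiable_const t')))
      (fun w v => hcoer w t' v) (u t') (u t)
    simp only [Function.comp_apply, id, hu, zero_sub, norm_neg] at h
    rw [hu, sub_zero, inv_mul_eq_div, le_div_iff₀ hc, mul_comm]
    exact h
  have hcont : Tendsto (fun t' => (u t', t')) (𝓝 t) (𝓝 (u t, t)) := by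
    refine Tendsto.prodMk_nhds ?_ tendsto_id
    have h0 : Tendsto (fun t' => t' - t) (𝓝 t) (𝓝 0) := by
      simpa using (continuous_id.sub continuous_const).tendsto (f := fun t' : F => t' - t) t
    exact tendsto_sub_nhds_zero_iff.1 (hO.trans_tendsto h0)
  have ho := (hG'.isLittleO.comp_tendsto hcont).trans_isBigO
    (hO.prod_left (isBigO_refl _ _))
  refine HasFDerivAt.of_isLittleO
    ((((Ring.inverse A).isBigO_comp _ _).trans_isLittleO ho).neg_left.congr_left fun t' => ?_)
  have hsplit : fderiv ℝ G (u t, t) ((u t', t') - (u t, t)) = A (u t' - u t) + B (t' - t) := by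
    rw [hA', hB, hB'.fderiv]
    simp [← map_add]
  simp only [Function.comp_apply, hsplit, hu, sub_self, zero_sub, map_neg, map_add, hleft,
    neg_neg, neg_apply, ContinuousLinearMap.comp_apply]
  abel

end StrongMonotone

/-- Let `J` be twice continuously differentiable with
`∇²_ww J(w,θ) ⪰ λ_w I` for some `λ_w > 0`, let `w⋆(θ)` be (a selection of) the unique
minimizer of `w ↦ J(w,θ)`, and let `J̃(θ) = J(w⋆(θ),θ)` be the reduced objective.  If `J̃` is
twice differentiable at `θ` (i.e. its gradient is differentiable at `θ`), then its Hessian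
equals the Schur complement of the `w`-block of the full Hessian of `J` at `(w⋆(θ), θ)`:
`∇²J̃(θ) = ∇²_θθ J - ∇²_θw J · (∇²_ww J)⁻¹ · ∇²_wθ J`. -/
theorem stmt7 {p q : ℕ}
    (J : EuclideanSpace ℝ (Fin p) × EuclideanSpace ℝ (Fin q) → ℝ)
    (lamw : ℝ) (hlamw : 0 < lamw)
    (hJ : ContDiff ℝ 2 J)
    (hconv : ∀ (w : EuclideanSpace ℝ (Fin p)) (θ : EuclideanSpace ℝ (Fin q))
        (v : EuclideanSpace ℝ (Fin p)),
      lamw * ‖v‖ ^ 2 ≤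
        ⟪v, (fderiv ℝ (fun w' => gradient (fun w'' => J (w'', θ)) w') w) v⟫)
    (wstar : EuclideanSpace ℝ (Fin q) → EuclideanSpace ℝ (Fin p))
    (hmin : ∀ θ w, J (wstar θ, θ) ≤ J (w, θ))
    (θ : EuclideanSpace ℝ (Fin q))
    (htwice : DifferentiableAt ℝ (fun t => gradient (fun t' => J (wstar t', t')) t) θ) :
    fderiv ℝ (fun t => gradient (fun t' => J (wstar t', t')) t) θ =
      fderiv ℝ (fun t => gradient (fun t' => J (wstar θ, t')) t) θ -
        (fderiv ℝ (fun a => gradient (fun t' => J (a, t')) θ) (wstar θ)) ∘L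
          (Ring.inverse
            (fderiv ℝ (fun a => gradient (fun a' => J (a', θ)) a) (wstar θ))) ∘L
          (fderiv ℝ (fun t => gradient (fun a' => J (a', t)) (wstar θ)) θ) := by
  have hdiff : Differentiable ℝ J := hJ.differentiable (by norm_num)
  have hzero (t) : gradient (fun w => J (w, t)) (wstar t) = 0 := by
    have h : IsLocalMin (fun w => J (w, t)) (wstar t) := Eventually.of_forall (hmin t)
    rw [gradient, h.fderiv_eq_zero, map_zero]
  have hw := hasFDerivAt_of_zero_of_coercive hlamw hJ.differentiable_gradient_fst
    (fun w t v => hconv w t v) hzero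
  have henv : (fun t => gradient (fun t' => J (wstar t', t')) t) =
      fun t => gradient (fun t' => J (wstar t, t')) t :=
    funext fun t => gradient_comp_eq_gradient_snd (hdiff _) (hw t).differentiableAt (hzero t)
  have hH := (hJ.differentiable_gradient_snd (wstar θ, θ)).hasFDerivAt
  have hfst := (HasFDerivAt.comp (f := fun w => (w, θ)) (wstar θ) hH
    (hasFDerivAt_prodMk_left _ _)).fderiv
  have hsnd := (HasFDerivAt.comp (f := fun t => (wstar θ, t)) θ hH
    (hasFDerivAt_prodMk_right _ _)).fderiv
  have hcomp := (HasFDerivAt.comp (f := fun t => (wstar t, t)) θ hH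
    ((hw θ).prodMk (hasFDerivAt_id θ))).fderiv
  simp only [Function.comp_def] at hfst hsnd hcomp
  rw [henv, hcomp, hfst, hsnd]
  ext1 v
  simp only [ContinuousLinearMap.comp_apply, sub_apply, ← map_sub]
  simp
end

section
/- Let M be a real symmetric positive definite (p+q)×(p+q) matrix written in block form M = [[P, B], [Bᵀ, C]] with P ∈ ℝ^{p×p}, B ∈ ℝ^{p×q}, C ∈ ℝ^{q×q}. Then every eigenvalue of the Schur complement S = C - BᵀP⁻¹B lies between the smallest and largest eigenvalues of M: λ_min(M) ≤ λ_min(S) and λ_max(S) ≤ λ_max(M). Consequently S is symmetric positive definite and its condition number satisfies κ(S) ≤ κ(M), where κ(X) = λ_max(X)/λ_min(X). -/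
open Matrix

namespace Matrix.IsHermitian

variable {n : Type*} [Fintype n] [DecidableEq n] {A : Matrix n n ℝ}

/-- The lower Rayleigh quotient bound for a real symmetric matrix. -/
theorem mul_dotProduct_self_le_of_le_eigenvalues (hA : A.IsHermitian) {c : ℝ}
    (hc : ∀ i, c ≤ hA.eigenvalues i) (x : n → ℝ) : c * (x ⬝ᵥ x) ≤ x ⬝ᵥ A *ᵥ x := by
  have h : (A - c • (1 : Matrix n n ℝ)).PosSemidef := by
    have hconj : A - c • (1 : Matrix n n ℝ) = Unitary.conjStarAlgAut ℝ _ hA.eigenvectorUnitary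
        (diagonal fun i => hA.eigenvalues i - c) := by
      rw [← diagonal_sub, ← smul_one_eq_diagonal, map_sub, map_smul, map_one]
      congr 1
      exact hA.spectral_theorem
    rw [hconj]
    simp [Unitary.isUnit_coe.posSemidef_star_right_conjugate_iff, hc]
  have := h.dotProduct_mulVec_nonneg x
  simpa [sub_mulVec, smul_mulVec, dotProduct_sub] using this

/-- The upper Rayleigh quotient bound for a real symmetric matrix. -/
theorem dotProduct_mulVec_le_of_eigenvalues_le (hA : A.IsHermitian) {c : ℝ}
    (hc : ∀ i, hA.eigenvalues i ≤ c) (x : n → ℝ) : x ⬝ᵥ A *ᵥ x ≤ c * (x ⬝ᵥ x) := by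
  have h : (c • (1 : Matrix n n ℝ) - A).PosSemidef := by
    have hconj : c • (1 : Matrix n n ℝ) - A = Unitary.conjStarAlgAut ℝ _ hA.eigenvectorUnitary
        (diagonal fun i => c - hA.eigenvalues i) := by
      rw [← diagonal_sub, ← smul_one_eq_diagonal, map_sub, map_smul, map_one]
      congr 1
      exact hA.spectral_theorem
    rw [hconj]
    simp [Unitary.isUnit_coe.posSemidef_star_right_conjugate_iff, hc]
  have := h.dotProduct_mulVec_nonneg x
  simpa [sub_mulVec, smul_mulVec, dotProduct_sub] using this

/-- Every eigenvalue is a value of the quadratic form on a unit vector. -/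
theorem exists_dotProduct_mulVec_eq_eigenvalues (hA : A.IsHermitian) (i : n) :
    ∃ v : n → ℝ, v ⬝ᵥ v = 1 ∧ v ⬝ᵥ A *ᵥ v = hA.eigenvalues i := by
  refine ⟨hA.eigenvectorBasis i, ?_, by simpa using (hA.eigenvalues_eq i).symm⟩
  have h := hA.eigenvectorBasis.inner_eq_one i
  rwa [EuclideanSpace.inner_eq_star_dotProduct, star_trivial] at h

end Matrix.IsHermitian

/-- Completing the square for the quadratic form of a real symmetric block matrix. -/
theorem Matrix.dotProduct_fromBlocks_mulVec_eq_schur {m n : Type*} [Fintype m] [Fintype n]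
    [DecidableEq m] {P : Matrix m m ℝ} (hP : P.PosDef) (B : Matrix m n ℝ) (C : Matrix n n ℝ)
    (x : m → ℝ) (y : n → ℝ) :
    Sum.elim x y ⬝ᵥ fromBlocks P B Bᵀ C *ᵥ Sum.elim x y =
      (x + (P⁻¹ * B) *ᵥ y) ⬝ᵥ P *ᵥ (x + (P⁻¹ * B) *ᵥ y) +
        y ⬝ᵥ (C - Bᵀ * P⁻¹ * B) *ᵥ y := by
  have := hP.isUnit.invertible
  simpa [dotProduct_mulVec] using schur_complement_eq₁₁ B C x y hP.isHermitian

/-- Let `M = [[P, B], [Bᵀ, C]]` be a symmetric positive definite real block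
matrix with `p, q ≥ 1`.  Then every eigenvalue of the Schur complement `S = C - BᵀP⁻¹B` lies
between the smallest and largest eigenvalues of `M`; consequently `S` is symmetric positive
definite and `κ(S) ≤ κ(M)`. -/
theorem stmt8 {p q : ℕ} (hp : 0 < p) (hq : 0 < q)
    (P : Matrix (Fin p) (Fin p) ℝ) (B : Matrix (Fin p) (Fin q) ℝ)
    (C : Matrix (Fin q) (Fin q) ℝ)
    (hM : (Matrix.fromBlocks P B Bᵀ C).PosDef)
    (hS : (C - Bᵀ * P⁻¹ * B).IsHermitian) :
    ((⨅ j, hM.1.eigenvalues j) ≤ ⨅ i, hS.eigenvalues i) ∧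
    ((⨆ i, hS.eigenvalues i) ≤ ⨆ j, hM.1.eigenvalues j) ∧
    (C - Bᵀ * P⁻¹ * B).PosDef ∧
    (⨆ i, hS.eigenvalues i) / (⨅ i, hS.eigenvalues i) ≤
      (⨆ j, hM.1.eigenvalues j) / (⨅ j, hM.1.eigenvalues j) := by
  have : Nonempty (Fin q) := ⟨⟨0, hq⟩⟩
  have hP : P.PosDef := hM.submatrix Sum.inl_injective
  have hbelow := Set.finite_range hM.1.eigenvalues |>.bddBelow
  have habove := Set.finite_range hM.1.eigenvalues |>.bddAbove
  have hmin_pos : 0 < ⨅ j, hM.1.eigenvalues j := by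
    obtain ⟨j, hj⟩ := exists_eq_ciInf_of_finite (f := hM.1.eigenvalues)
    exact hj ▸ hM.eigenvalues_pos j
  have hlower (i) : (⨅ j, hM.1.eigenvalues j) ≤ hS.eigenvalues i := by
    obtain ⟨v, hv, hvS⟩ := hS.exists_dotProduct_mulVec_eq_eigenvalues i
    have h := hM.1.mul_dotProduct_self_le_of_le_eigenvalues (ciInf_le hbelow)
      (Sum.elim (-((P⁻¹ * B) *ᵥ v)) v)
    rw [dotProduct_fromBlocks_mulVec_eq_schur hP, sumElim_dotProduct_sumElim, neg_add_cancel,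
      zero_dotProduct, zero_add, hv, hvS] at h
    refine le_trans (le_mul_of_one_le_right hmin_pos.le ?_) h
    exact le_add_of_nonneg_left (Finset.sum_nonneg fun _ _ => mul_self_nonneg _)
  have hupper (i) : hS.eigenvalues i ≤ ⨆ j, hM.1.eigenvalues j := by
    obtain ⟨v, hv, hvS⟩ := hS.exists_dotProduct_mulVec_eq_eigenvalues i
    have h := hM.1.dotProduct_mulVec_le_of_eigenvalues_le (le_ciSup habove) (Sum.elim 0 v)
    rw [dotProduct_fromBlocks_mulVec_eq_schur hP, sumElim_dotProduct_sumElim, zero_add,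
      zero_dotProduct, zero_add, hv, hvS, mul_one] at h
    have hnonneg := hP.posSemidef.dotProduct_mulVec_nonneg ((P⁻¹ * B) *ᵥ v)
    rw [star_trivial] at hnonneg
    linarith
  have hmin := le_ciInf hlower
  have hmax := ciSup_le hupper
  refine ⟨hmin, hmax, hS.posDef_iff_eigenvalues_pos.2 fun i => hmin_pos.trans_le (hlower i), ?_⟩
  have hmax_nonneg : 0 ≤ ⨆ j, hM.1.eigenvalues j :=
    Real.iSup_nonneg fun j => (hM.eigenvalues_pos j).le
  exact div_le_div₀ hmax_nonneg hmax hmin_pos hmin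
end

section
/- Let F be a real Hilbert space, g ∈ F with g ≠ 0, and B : F → F a self-adjoint positive semidefinite continuous linear operator with ‖B‖ ≤ β for some β > 0. Let Δ > 0, define the quadratic model Q(h) = ⟨g, h⟩ + (1/2)⟨h, Bh⟩, the Cauchy step size γ_C = Δ/‖g‖ if ⟨g, Bg⟩ = 0 and γ_C = min{Δ/‖g‖, ‖g‖²/⟨g, Bg⟩} otherwise, and the Cauchy point h_C = -γ_C g. Then the Cauchy point achieves the sufficient model reduction Q(0) - Q(h_C) ≥ (1/2)·‖g‖·min{Δ, ‖g‖/β}. -/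
open scoped RealInnerProductSpace Classical

/-- The quadratic model `Q(h) = ⟨g, h⟩ + (1/2)⟨h, Bh⟩`. -/
noncomputable def quadModel {F : Type*} [NormedAddCommGroup F] [InnerProductSpace ℝ F]
    (B : F →L[ℝ] F) (g : F) (h : F) : ℝ :=
  ⟪g, h⟫ + (1 / 2) * ⟪h, B h⟫

/-- The Cauchy step size: `Δ/‖g‖` if `⟨g, Bg⟩ = 0`, else `min{Δ/‖g‖, ‖g‖²/⟨g, Bg⟩}`. -/
noncomputable def cauchyStepSize {F : Type*} [NormedAddCommGroup F] [InnerProductSpace ℝ F]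
    (B : F →L[ℝ] F) (g : F) (Δ : ℝ) : ℝ :=
  if ⟪g, B g⟫ = (0 : ℝ) then Δ / ‖g‖ else min (Δ / ‖g‖) (‖g‖ ^ 2 / ⟪g, B g⟫)

/-- The Cauchy point `h_C = -γ_C g`. -/
noncomputable def cauchyPoint {F : Type*} [NormedAddCommGroup F] [InnerProductSpace ℝ F]
    (B : F →L[ℝ] F) (g : F) (Δ : ℝ) : F :=
  -(cauchyStepSize B g Δ • g)

theorem quadModel_sub_cauchyPoint {F : Type*} [NormedAddCommGroup F] [InnerProductSpace ℝ F]
    (B : F →L[ℝ] F) (g : F) (Δ : ℝ) :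
    quadModel B g 0 - quadModel B g (cauchyPoint B g Δ) =
      cauchyStepSize B g Δ * ‖g‖ ^ 2 - (1 / 2) * cauchyStepSize B g Δ ^ 2 * ⟪g, B g⟫ := by
  simp only [quadModel, cauchyPoint, map_neg, map_smul, map_zero, inner_zero_right,
    inner_neg_left, inner_neg_right, real_inner_smul_left, real_inner_smul_right,
    real_inner_self_eq_norm_sq]
  ring

theorem cauchyStepSize_nonneg {F : Type*} [NormedAddCommGroup F] [InnerProductSpace ℝ F]
    {B : F →L[ℝ] F} {g : F} (hB : 0 ≤ ⟪g, B g⟫) {Δ : ℝ} (hΔ : 0 ≤ Δ) :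
    0 ≤ cauchyStepSize B g Δ := by
  unfold cauchyStepSize
  split_ifs <;> positivity

theorem cauchyStepSize_mul_inner_le {F : Type*} [NormedAddCommGroup F] [InnerProductSpace ℝ F]
    {B : F →L[ℝ] F} {g : F} (hB : 0 ≤ ⟪g, B g⟫) (Δ : ℝ) :
    cauchyStepSize B g Δ * ⟪g, B g⟫ ≤ ‖g‖ ^ 2 := by
  unfold cauchyStepSize
  split_ifs with h
  · rw [h, mul_zero]
    positivity
  · calc
      _ ≤ ‖g‖ ^ 2 / ⟪g, B g⟫ * ⟪g, B g⟫ := by gcongr; exact min_le_right _ _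
      _ = ‖g‖ ^ 2 := div_mul_cancel₀ _ h

theorem real_inner_apply_self_le {F : Type*} [NormedAddCommGroup F] [InnerProductSpace ℝ F]
    {B : F →L[ℝ] F} {β : ℝ} (hB : ‖B‖ ≤ β) (g : F) : ⟪g, B g⟫ ≤ β * ‖g‖ ^ 2 :=
  calc
    ⟪g, B g⟫ ≤ ‖g‖ * ‖B g‖ := real_inner_le_norm _ _
    _ ≤ ‖g‖ * (β * ‖g‖) := by gcongr; exact B.le_of_opNorm_le hB g
    _ = β * ‖g‖ ^ 2 := by ring

theorem min_le_cauchyStepSize_mul_norm {F : Type*} [NormedAddCommGroup F]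
    [InnerProductSpace ℝ F] {B : F →L[ℝ] F} {g : F} (hg : g ≠ 0) (hBg : 0 ≤ ⟪g, B g⟫) {β : ℝ}
    (hβ : 0 < β) (hB : ‖B‖ ≤ β) (Δ : ℝ) :
    min Δ (‖g‖ / β) ≤ cauchyStepSize B g Δ * ‖g‖ := by
  have hn : 0 < ‖g‖ := norm_pos_iff.mpr hg
  unfold cauchyStepSize
  split_ifs with h
  · rw [div_mul_cancel₀ _ hn.ne']
    exact min_le_left _ _
  · have hpos : 0 < ⟪g, B g⟫ := lt_of_le_of_ne hBg (Ne.symm h)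
    rw [min_mul_of_nonneg _ _ hn.le, div_mul_cancel₀ _ hn.ne']
    refine min_le_min le_rfl ?_
    rw [div_mul_eq_mul_div, div_le_div_iff₀ hβ hpos]
    calc
      ‖g‖ * ⟪g, B g⟫ ≤ ‖g‖ * (β * ‖g‖ ^ 2) := by
        gcongr
        exact real_inner_apply_self_le hB g
      _ = ‖g‖ ^ 2 * ‖g‖ * β := by ring

/-- For a self-adjoint positive semidefinite `B` with `‖B‖ ≤ β`, `g ≠ 0`, and
trust-region radius `Δ > 0`, the Cauchy point achieves the sufficient model reduction
`Q(0) - Q(h_C) ≥ (1/2)·‖g‖·min{Δ, ‖g‖/β}`. -/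
theorem stmt10 {F : Type*} [NormedAddCommGroup F] [InnerProductSpace ℝ F]
    (g : F) (hg : g ≠ 0)
    (B : F →L[ℝ] F) (hBsa : ∀ x y : F, ⟪B x, y⟫ = ⟪x, B y⟫)
    (hBpsd : ∀ x : F, 0 ≤ ⟪x, B x⟫)
    (β : ℝ) (hβ : 0 < β) (hBnorm : ‖B‖ ≤ β)
    (Δ : ℝ) (hΔ : 0 < Δ) :
    (1 / 2) * ‖g‖ * min Δ (‖g‖ / β) ≤
      quadModel B g 0 - quadModel B g (cauchyPoint B g Δ) := by
  have hγ := cauchyStepSize_nonneg (hBpsd g) hΔ.le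
  have hred : (1 / 2) * (cauchyStepSize B g Δ * ‖g‖ ^ 2) ≤
      quadModel B g 0 - quadModel B g (cauchyPoint B g Δ) := by
    rw [quadModel_sub_cauchyPoint]
    linarith [mul_le_mul_of_nonneg_left (cauchyStepSize_mul_inner_le (hBpsd g) Δ) hγ]
  calc
    (1 / 2) * ‖g‖ * min Δ (‖g‖ / β) ≤ (1 / 2) * ‖g‖ * (cauchyStepSize B g Δ * ‖g‖) := by
      gcongr
      exact min_le_cauchyStepSize_mul_norm hg (hBpsd g) hβ hBnorm Δ
    _ = (1 / 2) * (cauchyStepSize B g Δ * ‖g‖ ^ 2) := by ring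
    _ ≤ _ := hred
end

section
/- In the VarPro quadratic setting with λ > 0 and w⋆ = -(H + λI)⁻¹ḡ, the model reduction achieved by the VarPro weak learner h⋆ = A w⋆ satisfies the exact identity Q(0) - Q(A w⋆) = w⋆ᵀ((1/2)H + λI)w⋆, and consequently Q(0) - Q(A w⋆) ≥ λ‖w⋆‖². In particular, the predicted model reduction is strictly positive whenever the reduced gradient ḡ = A†g is nonzero. -/
open scoped RealInnerProductSpace

/-- The reduced Hessian `H = A† ∘ B ∘ A` on `ℝⁿ`. -/
noncomputable def redHess {n : ℕ} {F : Type*} [NormedAddCommGroup F] [InnerProductSpace ℝ F]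
    [CompleteSpace F] (A : EuclideanSpace ℝ (Fin n) →L[ℝ] F) (B : F →L[ℝ] F) :
    EuclideanSpace ℝ (Fin n) →L[ℝ] EuclideanSpace ℝ (Fin n) :=
  ContinuousLinearMap.adjoint A ∘L B ∘L A

/-- The VarPro optimal linear weights `w⋆ = -(H + λI)⁻¹ ḡ` with `ḡ = A†g`. -/
noncomputable def varproW {n : ℕ} {F : Type*} [NormedAddCommGroup F] [InnerProductSpace ℝ F]
    [CompleteSpace F] (A : EuclideanSpace ℝ (Fin n) →L[ℝ] F) (B : F →L[ℝ] F) (g : F)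
    (lam : ℝ) : EuclideanSpace ℝ (Fin n) :=
  -((Ring.inverse (redHess A B +
      lam • (1 : EuclideanSpace ℝ (Fin n) →L[ℝ] EuclideanSpace ℝ (Fin n))))
    (ContinuousLinearMap.adjoint A g))

theorem inner_redHess {n : ℕ} {F : Type*} [NormedAddCommGroup F] [InnerProductSpace ℝ F]
    [CompleteSpace F] (A : EuclideanSpace ℝ (Fin n) →L[ℝ] F) (B : F →L[ℝ] F)
    (v w : EuclideanSpace ℝ (Fin n)) : ⟪v, redHess A B w⟫ = ⟪A v, B (A w)⟫ := by
  simp [redHess, ContinuousLinearMap.adjoint_inner_right]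

/-- A monotone operator on a finite-dimensional space becomes invertible after adding a
positive multiple of the identity. -/
theorem isUnit_add_smul_one_of_inner_nonneg {E : Type*} [NormedAddCommGroup E]
    [InnerProductSpace ℝ E] [FiniteDimensional ℝ E] {T : E →L[ℝ] E}
    (hT : ∀ x, 0 ≤ ⟪x, T x⟫) {c : ℝ} (hc : 0 < c) :
    IsUnit (T + c • (1 : E →L[ℝ] E)) := by
  have : CompleteSpace E := FiniteDimensional.complete ℝ E
  rw [ContinuousLinearMap.isUnit_iff_bijective]
  have hinj : Function.Injective (T + c • (1 : E →L[ℝ] E)) := by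
    rw [injective_iff_map_eq_zero]
    intro x hx
    have h : ⟪x, (T + c • (1 : E →L[ℝ] E)) x⟫ = 0 := by rw [hx, inner_zero_right]
    simp only [add_apply, smul_apply,
      one_apply_eq_self, inner_add_right, real_inner_smul_right,
      real_inner_self_eq_norm_sq] at h
    have hsq : c * ‖x‖ ^ 2 = 0 := le_antisymm (by linarith [hT x]) (by positivity)
    simpa [hc.ne'] using hsq
  exact ⟨hinj, LinearMap.injective_iff_surjective
    (f := (T + c • (1 : E →L[ℝ] E) : E →L[ℝ] E).toLinearMap) |>.mp hinj⟩

/-- The normal equation `(H + λI) w⋆ = -ḡ`. -/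
theorem redHess_varproW_add {n : ℕ} {F : Type*} [NormedAddCommGroup F] [InnerProductSpace ℝ F]
    [CompleteSpace F] (A : EuclideanSpace ℝ (Fin n) →L[ℝ] F) (B : F →L[ℝ] F)
    (hB : ∀ x : F, 0 ≤ ⟪x, B x⟫) (g : F) {lam : ℝ} (hlam : 0 < lam) :
    redHess A B (varproW A B g lam) + lam • varproW A B g lam =
      -ContinuousLinearMap.adjoint A g := by
  have hu := isUnit_add_smul_one_of_inner_nonneg (T := redHess A B)
    (fun x => by rw [inner_redHess]; exact hB (A x)) hlam
  have h := DFunLike.congr_fun (Ring.mul_inverse_cancel _ hu) (ContinuousLinearMap.adjoint A g)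
  rw [mul_apply_eq_comp, one_apply_eq_self] at h
  change (redHess A B + lam • (1 : EuclideanSpace ℝ (Fin n) →L[ℝ] EuclideanSpace ℝ (Fin n)))
    (varproW A B g lam) = _
  rw [varproW, map_neg, h]

/-- In the VarPro quadratic setting with `λ > 0` and `w⋆ = -(H + λI)⁻¹ḡ`, the
model reduction of the VarPro weak learner `h⋆ = A w⋆` satisfies the exact identity
`Q(0) - Q(A w⋆) = w⋆ᵀ((1/2)H + λI)w⋆`, hence `Q(0) - Q(A w⋆) ≥ λ‖w⋆‖²`, and it is strictly
positive whenever the reduced gradient `ḡ = A†g` is nonzero. -/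
theorem stmt11 {n : ℕ} {F : Type*} [NormedAddCommGroup F] [InnerProductSpace ℝ F]
    [CompleteSpace F]
    (A : EuclideanSpace ℝ (Fin n) →L[ℝ] F) (hA : A ≠ 0)
    (B : F →L[ℝ] F) (hBsa : ∀ x y : F, ⟪B x, y⟫ = ⟪x, B y⟫)
    (hBpsd : ∀ x : F, 0 ≤ ⟪x, B x⟫)
    (g : F) (lam : ℝ) (hlam : 0 < lam) :
    quadModel B g 0 - quadModel B g (A (varproW A B g lam)) =
      ⟪varproW A B g lam,
        (((1 : ℝ) / 2) • redHess A B +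
          lam • (1 : EuclideanSpace ℝ (Fin n) →L[ℝ] EuclideanSpace ℝ (Fin n)))
        (varproW A B g lam)⟫ ∧
    lam * ‖varproW A B g lam‖ ^ 2 ≤
      quadModel B g 0 - quadModel B g (A (varproW A B g lam)) ∧
    (ContinuousLinearMap.adjoint A g ≠ 0 →
      0 < quadModel B g 0 - quadModel B g (A (varproW A B g lam))) := by
  have hN := redHess_varproW_add A B hBpsd g hlam
  set w := varproW A B g lam
  have hg : ⟪w, redHess A B w⟫ + lam * ‖w‖ ^ 2 = -⟪g, A w⟫ := by
    rw [← real_inner_self_eq_norm_sq, ← real_inner_smul_right, ← inner_add_right, hN,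
      inner_neg_right, ContinuousLinearMap.adjoint_inner_right, real_inner_comm]
  have hred : quadModel B g 0 - quadModel B g (A w) =
      1 / 2 * ⟪w, redHess A B w⟫ + lam * ‖w‖ ^ 2 := by
    simp only [quadModel, map_zero, inner_zero_right, ← inner_redHess]
    linarith
  have hH : 0 ≤ ⟪w, redHess A B w⟫ := by
    rw [inner_redHess]
    exact hBpsd (A w)
  rw [hred]
  refine ⟨?_, by linarith, fun hne => ?_⟩
  · simp only [add_apply, smul_apply,
      one_apply_eq_self, inner_add_right, real_inner_smul_right,
      real_inner_self_eq_norm_sq]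
  · have hw : w ≠ 0 := by
      intro hw
      rw [hw, map_zero, smul_zero, add_zero] at hN
      exact hne (neg_eq_zero.mp hN.symm)
    have : 0 < lam * ‖w‖ ^ 2 := by positivity
    linarith
end

section
/- (VarPro model reduction lower bound.) In the VarPro quadratic setting, assume: g ≠ 0; ‖B‖ ≤ β with β > 0; 0 < α_low ≤ ‖A‖ ≤ α_high; λ ≥ λ_low > 0; gradient alignment ‖ḡ‖ ≥ κ_align·‖A‖·‖g‖ with κ_align ∈ (0,1]; and curvature capture ⟨A w⋆, B(A w⋆)⟩ ≥ κ_curve·⟨g, Bg⟩ with κ_curve > 0, where w⋆ = -(H + λI)⁻¹ḡ. Then the VarPro model reduction satisfies Q(0) - Q(A w⋆) ≥ c₁·‖g‖²·κ_align/(β + λ/α_low²), where c₁ = c₂/2 and c₂ = min{ κ_align·λ_low/(α_high²·β + λ_low), κ_curve·λ_low²/α_high⁴ }. -/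
open scoped RealInnerProductSpace

/-- A symmetric positive semidefinite `T` with `⟪v, T v⟫ ≤ L * ‖v‖ ^ 2` is `L⁻¹`-cocoercive. -/
theorem norm_sq_apply_le_mul_inner {E : Type*} [NormedAddCommGroup E] [InnerProductSpace ℝ E]
    (T : E →L[ℝ] E) (hsymm : ∀ x y, ⟪T x, y⟫ = ⟪x, T y⟫) (hpos : ∀ x, 0 ≤ ⟪x, T x⟫)
    {L : ℝ} (hL : 0 < L) (hle : ∀ v, ⟪v, T v⟫ ≤ L * ‖v‖ ^ 2) (w : E) :
    ‖T w‖ ^ 2 ≤ L * ⟪w, T w⟫ := by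
  have h := hpos (L • w - T w)
  have hexp : ⟪L • w - T w, T (L • w - T w)⟫ =
      L ^ 2 * ⟪w, T w⟫ - 2 * L * ‖T w‖ ^ 2 + ⟪T w, T (T w)⟫ := by
    simp only [map_sub, map_smul, inner_sub_left, inner_sub_right, real_inner_smul_left,
      real_inner_smul_right, ← hsymm w (T w), real_inner_self_eq_norm_sq]
    ring
  have h2 := hle (T w)
  refine le_of_mul_le_mul_left ?_ hL
  nlinarith

theorem inner_map_le_mul_norm_sq {E F : Type*} [NormedAddCommGroup E]
    [InnerProductSpace ℝ E] [NormedAddCommGroup F] [InnerProductSpace ℝ F]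
    (A : E →L[ℝ] F) {B : F →L[ℝ] F} {β : ℝ} (hB : ‖B‖ ≤ β) (v : E) :
    ⟪A v, B (A v)⟫ ≤ ‖A‖ ^ 2 * β * ‖v‖ ^ 2 := by
  have hβ : 0 ≤ β := (norm_nonneg B).trans hB
  calc ⟪A v, B (A v)⟫ ≤ ‖A v‖ * ‖B (A v)‖ := real_inner_le_norm _ _
    _ ≤ ‖A v‖ * (β * ‖A v‖) := by gcongr; exact B.le_of_opNorm_le hB _
    _ = β * ‖A v‖ ^ 2 := by ring
    _ ≤ β * (‖A‖ * ‖v‖) ^ 2 := by gcongr; exact A.le_opNorm v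
    _ = ‖A‖ ^ 2 * β * ‖v‖ ^ 2 := by ring

section RegularizedHessian

variable {n : ℕ} {F : Type*} [NormedAddCommGroup F] [InnerProductSpace ℝ F] [CompleteSpace F]
  (A : EuclideanSpace ℝ (Fin n) →L[ℝ] F) (B : F →L[ℝ] F)

theorem inner_redHess_add_smul_one_apply (lam : ℝ) (v u : EuclideanSpace ℝ (Fin n)) :
    ⟪v, (redHess A B + lam • (1 : EuclideanSpace ℝ (Fin n) →L[ℝ] EuclideanSpace ℝ (Fin n))) u⟫ =
      ⟪A v, B (A u)⟫ + lam * ⟪v, u⟫ := by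
  simp [redHess, inner_add_right, real_inner_smul_right, ContinuousLinearMap.adjoint_inner_right]

variable {B}

theorem isUnit_redHess_add_smul_one (hB : ∀ x : F, 0 ≤ ⟪x, B x⟫) {lam : ℝ} (hlam : 0 < lam) :
    IsUnit (redHess A B +
      lam • (1 : EuclideanSpace ℝ (Fin n) →L[ℝ] EuclideanSpace ℝ (Fin n))) := by
  set T := redHess A B + lam • (1 : EuclideanSpace ℝ (Fin n) →L[ℝ] EuclideanSpace ℝ (Fin n))
    with hT
  have hinj : Function.Injective T := by
    refine (injective_iff_map_eq_zero T).2 fun v hv => ?_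
    have h := inner_redHess_add_smul_one_apply A B lam v v
    rw [← hT, hv, inner_zero_right, real_inner_self_eq_norm_sq] at h
    have h1 : ‖v‖ ^ 2 = 0 := by nlinarith [hB (A v), sq_nonneg ‖v‖]
    simpa using h1
  exact ContinuousLinearMap.isUnit_iff_bijective.2
    ⟨hinj, (LinearMap.injective_iff_surjective (f := T.toLinearMap)).1 hinj⟩

theorem redHess_add_smul_one_varproW (hB : ∀ x : F, 0 ≤ ⟪x, B x⟫) (g : F) {lam : ℝ}
    (hlam : 0 < lam) :
    (redHess A B + lam • (1 : EuclideanSpace ℝ (Fin n) →L[ℝ] EuclideanSpace ℝ (Fin n)))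
      (varproW A B g lam) = -ContinuousLinearMap.adjoint A g := by
  rw [varproW, map_neg, ← mul_apply_eq_comp,
    Ring.mul_inverse_cancel _ (isUnit_redHess_add_smul_one A hB hlam),
    one_apply_eq_self]

/-- The VarPro step reduces the model by at least `‖A†g‖² / (2 (‖A‖²β + λ))`. -/
theorem norm_adjoint_sq_le_quadModel_sub (hBsa : ∀ x y : F, ⟪B x, y⟫ = ⟪x, B y⟫)
    (hB : ∀ x : F, 0 ≤ ⟪x, B x⟫) (g : F) {β lam : ℝ} (hBnorm : ‖B‖ ≤ β) (hlam : 0 < lam) :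
    ‖ContinuousLinearMap.adjoint A g‖ ^ 2 ≤ 2 * (‖A‖ ^ 2 * β + lam) *
      (quadModel B g 0 - quadModel B g (A (varproW A B g lam))) := by
  have hβ : 0 ≤ β := (norm_nonneg B).trans hBnorm
  have hL : 0 < ‖A‖ ^ 2 * β + lam := by positivity
  set T := redHess A B + lam • (1 : EuclideanSpace ℝ (Fin n) →L[ℝ] EuclideanSpace ℝ (Fin n))
  have hT : ∀ v u, ⟪v, T u⟫ = ⟪A v, B (A u)⟫ + lam * ⟪v, u⟫ :=
    inner_redHess_add_smul_one_apply A B lam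
  set w := varproW A B g lam
  have hw : T w = -ContinuousLinearMap.adjoint A g := redHess_add_smul_one_varproW A hB g hlam
  have hco := norm_sq_apply_le_mul_inner T
    (fun x y => by
      rw [real_inner_comm, hT, hT, real_inner_comm x y, ← hBsa, real_inner_comm])
    (fun x => by
      rw [hT, real_inner_self_eq_norm_sq]
      have := hB (A x)
      positivity)
    hL
    (fun v => by
      rw [hT, real_inner_self_eq_norm_sq, add_mul]
      gcongr
      exact inner_map_le_mul_norm_sq A hBnorm v) w
  have hgw : ⟪g, A w⟫ = -⟪w, T w⟫ := by
    rw [hw, inner_neg_right, ContinuousLinearMap.adjoint_inner_right, neg_neg, real_inner_comm]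
  have hTw := hT w w
  rw [real_inner_self_eq_norm_sq] at hTw
  have hred : ⟪w, T w⟫ ≤ 2 * (quadModel B g 0 - quadModel B g (A w)) := by
    simp only [quadModel, inner_zero_left, inner_zero_right, hgw]
    nlinarith [sq_nonneg ‖w‖]
  have hnorm : ‖T w‖ = ‖ContinuousLinearMap.adjoint A g‖ := by rw [hw, norm_neg]
  rw [hnorm] at hco
  exact hco.trans ((mul_le_mul_of_nonneg_left hred hL.le).trans_eq (by ring))

end RegularizedHessian

/-- **VarPro model reduction lower bound.** Under the subspace-regularity
hypotheses, the VarPro model reduction satisfies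
`Q(0) - Q(A w⋆) ≥ c₁ · ‖g‖² · κ_align / (β + λ/α_low²)`, where `c₁ = c₂/2` and
`c₂ = min{κ_align·λ_low/(α_high²β + λ_low), κ_curve·λ_low²/α_high⁴}`. -/
theorem stmt13 {n : ℕ} {F : Type*} [NormedAddCommGroup F] [InnerProductSpace ℝ F]
    [CompleteSpace F]
    (A : EuclideanSpace ℝ (Fin n) →L[ℝ] F) (hA : A ≠ 0)
    (B : F →L[ℝ] F) (hBsa : ∀ x y : F, ⟪B x, y⟫ = ⟪x, B y⟫)
    (hBpsd : ∀ x : F, 0 ≤ ⟪x, B x⟫)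
    (g : F) (hg : g ≠ 0)
    (β αlow αhigh lam lamLow κa κc : ℝ)
    (hβ : 0 < β) (hBnorm : ‖B‖ ≤ β)
    (hαlow : 0 < αlow) (hA1 : αlow ≤ ‖A‖) (hA2 : ‖A‖ ≤ αhigh)
    (hlamLow : 0 < lamLow) (hlam : lamLow ≤ lam)
    (hκa0 : 0 < κa) (hκa1 : κa ≤ 1) (hκc : 0 < κc)
    (halign : κa * ‖A‖ * ‖g‖ ≤ ‖ContinuousLinearMap.adjoint A g‖)
    (hcurve : κc * ⟪g, B g⟫ ≤
      ⟪A (varproW A B g lam), B (A (varproW A B g lam))⟫) :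
    (min (κa * lamLow / (αhigh ^ 2 * β + lamLow)) (κc * lamLow ^ 2 / αhigh ^ 4) / 2) *
        (‖g‖ ^ 2 * κa / (β + lam / αlow ^ 2)) ≤
      quadModel B g 0 - quadModel B g (A (varproW A B g lam)) := by
  have hlam0 : 0 < lam := hlamLow.trans_le hlam
  have hA0 : 0 < ‖A‖ := hαlow.trans_le hA1
  have hc : min (κa * lamLow / (αhigh ^ 2 * β + lamLow)) (κc * lamLow ^ 2 / αhigh ^ 4) ≤ κa := by
    refine (min_le_left _ _).trans ?_
    rw [div_le_iff₀ (by positivity)]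
    gcongr
    exact le_add_of_nonneg_left (by positivity)
  have hmain := norm_adjoint_sq_le_quadModel_sub A hBsa hBpsd g hBnorm hlam0
  calc _ ≤ κa / 2 * (‖g‖ ^ 2 * κa / (β + lam / ‖A‖ ^ 2)) := by gcongr
    _ = (κa * ‖A‖ * ‖g‖) ^ 2 / (2 * (‖A‖ ^ 2 * β + lam)) := by
      field_simp
    _ ≤ ‖ContinuousLinearMap.adjoint A g‖ ^ 2 / (2 * (‖A‖ ^ 2 * β + lam)) := by gcongr
    _ ≤ _ := by
      rwa [div_le_iff₀' (by positivity)]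
end

section
/- (VPBoost has a stationary limit point.) In the VPBoost setting with acceptance threshold ρ_accept = 0, the iterates produced by the algorithm satisfy liminf_{m→∞} ‖∇L(f_m)‖ = 0. -/
open scoped RealInnerProductSpace
open Filter

/-- The descent lemma: a function with `β`-bounded derivative of its gradient lies below the
corresponding quadratic. -/
theorem descent_of_norm_fderiv_gradient_le {F : Type*} [NormedAddCommGroup F]
    [InnerProductSpace ℝ F] [CompleteSpace F] {L : F → ℝ} {β : ℝ} (hL : ContDiff ℝ 2 L)
    (hH : ∀ x : F, ‖fderiv ℝ (gradient L) x‖ ≤ β) (x h : F) :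
    L (x + h) ≤ L x + ⟪gradient L x, h⟫ + β / 2 * ‖h‖ ^ 2 := by
  have hLd : Differentiable ℝ L := hL.differentiable (by norm_num)
  have hgd : Differentiable ℝ (gradient L) := by
    have h1 : Differentiable ℝ (fderiv ℝ L) :=
      (hL.fderiv_right (m := 1) (by norm_num)).differentiable (by norm_num)
    exact (InnerProductSpace.toDual ℝ F).symm.differentiable.comp h1
  have hlip (y : F) : ‖gradient L y - gradient L x‖ ≤ β * ‖y - x‖ :=
    convex_univ.norm_image_sub_le_of_norm_fderiv_le (𝕜 := ℝ) (fun z _ => hgd z)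
      (fun z _ => hH z) (Set.mem_univ _) (Set.mem_univ _)
  have hderiv (t : ℝ) : HasDerivAt
      (fun t : ℝ => L (x + t • h) - t * ⟪gradient L x, h⟫ - β / 2 * ‖h‖ ^ 2 * t ^ 2)
      (⟪gradient L (x + t • h), h⟫ - ⟪gradient L x, h⟫ - β * ‖h‖ ^ 2 * t) t := by
    have h1 : HasDerivAt (fun t : ℝ => x + t • h) h t := by
      simpa using ((hasDerivAt_id t).smul_const h).const_add x
    have h2 := (hLd (x + t • h)).hasGradientAt.hasFDerivAt.comp_hasDerivAt t h1
    have h3 := (h2.sub ((hasDerivAt_id t).mul_const ⟪gradient L x, h⟫)).sub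
      (((hasDerivAt_id t).pow 2).const_mul (β / 2 * ‖h‖ ^ 2))
    refine h3.congr_deriv ?_
    simp
    ring
  have hanti := antitoneOn_of_deriv_nonpos (convex_Icc (0 : ℝ) 1)
    (fun t _ => (hderiv t).continuousAt.continuousWithinAt)
    (fun t _ => (hderiv t).differentiableAt.differentiableWithinAt) (fun t ht => by
      rw [interior_Icc] at ht
      rw [(hderiv t).deriv, ← inner_sub_left]
      have h1 := real_inner_le_norm (gradient L (x + t • h) - gradient L x) h
      have h2 := hlip (x + t • h)
      rw [add_sub_cancel_left, norm_smul, Real.norm_of_nonneg ht.1.le] at h2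
      nlinarith [mul_le_mul_of_nonneg_right h2 (norm_nonneg h)])
  have h01 := hanti (by simp : (0 : ℝ) ∈ Set.Icc (0 : ℝ) 1)
    (by simp : (1 : ℝ) ∈ Set.Icc (0 : ℝ) 1) zero_le_one
  simp only [one_smul, zero_smul, add_zero] at h01
  linarith

/-- A positive semidefinite operator on a finite-dimensional space becomes invertible after adding
a positive multiple of the identity. -/
theorem isUnit_add_smul_one_of_inner_nonneg_s15 {E : Type*} [NormedAddCommGroup E]
    [InnerProductSpace ℝ E] [FiniteDimensional ℝ E] {H : E →L[ℝ] E} (hH : ∀ v, 0 ≤ ⟪v, H v⟫)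
    {l : ℝ} (hl : 0 < l) : IsUnit (H + l • (1 : E →L[ℝ] E)) := by
  set T := H + l • (1 : E →L[ℝ] E) with hT
  have hinj : Function.Injective T.toLinearMap := by
    refine (injective_iff_map_eq_zero _).2 fun v hv => ?_
    have h1 : ⟪v, T v⟫ = 0 := by
      rw [show T v = 0 from hv, inner_zero_right]
    rw [hT] at h1
    simp only [add_apply, smul_apply, one_apply_eq_self,
      inner_add_right, inner_smul_right, real_inner_self_eq_norm_sq] at h1
    have h2 : ‖v‖ ^ 2 = 0 := by nlinarith [hH v, sq_nonneg ‖v‖]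
    simpa using h2
  exact ⟨ContinuousLinearEquiv.toUnit
    (LinearEquiv.ofInjectiveEndo T.toLinearMap hinj).toContinuousLinearEquiv, by ext v; rfl⟩

/-- A monotone sequence which is multiplied by a fixed factor above one whenever `p` holds, and
which never grows again above a threshold, is bounded, and `p` eventually fails. -/
theorem bounded_and_eventually_not_of_growth {lam : ℕ → ℝ} {p : ℕ → Prop} {γ l T : ℝ}
    (hγ : 1 < γ) (hl : 0 < l) (h0 : l ≤ lam 0) (hup : ∀ m, p m → lam (m + 1) = γ * lam m)
    (hstay : ∀ m, ¬ p m → lam (m + 1) = lam m)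
    (hT : ∀ m, l ≤ lam m → T ≤ lam m → ¬ p m) :
    (∀ m, l ≤ lam m) ∧ (∃ M, ∀ m, lam m ≤ M) ∧ ∀ᶠ m in atTop, ¬ p m := by
  have hlow : ∀ m, l ≤ lam m := by
    intro m
    induction m with
    | zero => exact h0
    | succ m ih =>
      by_cases hp : p m
      · rw [hup m hp]; nlinarith
      · rwa [hstay m hp]
  have hmono : Monotone lam := monotone_nat_of_le_succ fun m => by
    by_cases hp : p m
    · rw [hup m hp]; nlinarith [hlow m]
    · rw [hstay m hp]
  have hbound : ∀ m, lam m ≤ max (lam 0) (γ * T) := by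
    intro m
    induction m with
    | zero => exact le_max_left _ _
    | succ m ih =>
      by_cases hp : p m
      · have : lam m < T := lt_of_not_ge fun h => hT m (hlow m) h hp
        rw [hup m hp]
        exact le_max_of_le_right (by nlinarith)
      · rwa [hstay m hp]
  refine ⟨hlow, ⟨_, hbound⟩, ?_⟩
  have hlim := tendsto_atTop_ciSup hmono ⟨_, Set.forall_mem_range.2 hbound⟩
  have hdiff := ((tendsto_add_atTop_iff_nat 1).2 hlim).sub hlim
  rw [sub_self] at hdiff
  filter_upwards [hdiff.eventually_lt_const (show 0 < (γ - 1) * l by nlinarith)] with m hm hp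
  rw [hup m hp] at hm
  nlinarith [hlow m]

/-- If a sequence bounded below eventually decreases by at least `c * ‖u m‖ ^ 2` at each step, then
`‖u m‖` tends to zero. -/
theorem tendsto_norm_zero_of_sufficient_decrease {F : Type*} [NormedAddCommGroup F] {u : ℕ → F}
    {a : ℕ → ℝ} {c : ℝ} (hc : 0 < c) (ha : BddBelow (Set.range a))
    (hdec : ∀ᶠ m in atTop, c * ‖u m‖ ^ 2 ≤ a m - a (m + 1)) :
    Tendsto (fun m => ‖u m‖) atTop (nhds 0) := by
  obtain ⟨N, hN⟩ := eventually_atTop.1 hdec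
  have hanti : Antitone fun m => a (m + N) := antitone_nat_of_succ_le fun m => by
    have := hN (m + N) (by omega)
    rw [show m + 1 + N = m + N + 1 by omega]
    nlinarith [sq_nonneg ‖u (m + N)‖]
  have hlim := (tendsto_add_atTop_iff_nat N).1 (tendsto_atTop_ciInf hanti
    (ha.mono (by rintro _ ⟨m, rfl⟩; exact ⟨m + N, rfl⟩)))
  have hdiff := hlim.sub ((tendsto_add_atTop_iff_nat 1).2 hlim)
  rw [sub_self] at hdiff
  have hsq : Tendsto (fun m => ‖u m‖ ^ 2) atTop (nhds 0) := by
    refine squeeze_zero' (Eventually.of_forall fun m => sq_nonneg _) ?_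
      (by simpa using hdiff.div_const c)
    filter_upwards [hdec] with m hm
    rw [le_div_iff₀ hc]
    linarith
  simpa using hsq.sqrt

/-- **VPBoost has a stationary limit point.** In the VPBoost setting with
acceptance threshold `ρ_accept = 0`, the iterates satisfy `liminf ‖∇L(f_m)‖ = 0`. -/
theorem stmt15
    {F : Type*} [NormedAddCommGroup F] [InnerProductSpace ℝ F] [CompleteSpace F]
    (n : ℕ) (L : F → ℝ)
    (β ρa ρs γup lamLow αlow αhigh κa κc : ℝ)
    -- regularity of the loss functional
    (hL : ContDiff ℝ 2 L)
    (hbdd : BddBelow (Set.range L))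
    (hβ : 0 < β)
    (hHsa : ∀ x u v : F,
      ⟪(fderiv ℝ (gradient L) x) u, v⟫ = ⟪u, (fderiv ℝ (gradient L) x) v⟫)
    (hHpsd : ∀ x u : F, 0 ≤ ⟪u, (fderiv ℝ (gradient L) x) u⟫)
    (hHnorm : ∀ x : F, ‖fderiv ℝ (gradient L) x‖ ≤ β)
    -- fixed constants
    (hρa0 : 0 ≤ ρa) (hρas : ρa < ρs) (hρs1 : ρs < 1)
    (hγup : 1 < γup) (hlamLow : 0 < lamLow)
    (hαlow : 0 < αlow) (hαle : αlow ≤ αhigh)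
    (hκa0 : 0 < κa) (hκa1 : κa ≤ 1) (hκc : 0 < κc)
    -- the iterates of the algorithm
    (f : ℕ → F) (lam : ℕ → ℝ) (A : ℕ → EuclideanSpace ℝ (Fin n) →L[ℝ] F)
    (hlam0 : lamLow ≤ lam 0)
    -- derived quantities at stage m
    (g : ℕ → F) (hg : ∀ m, g m = gradient L (f m))
    (Hess : ℕ → F →L[ℝ] F) (hHess : ∀ m, Hess m = fderiv ℝ (gradient L) (f m))
    (gbar : ℕ → EuclideanSpace ℝ (Fin n))
    (hgbar : ∀ m, gbar m = ContinuousLinearMap.adjoint (A m) (g m))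
    (Hred : ℕ → EuclideanSpace ℝ (Fin n) →L[ℝ] EuclideanSpace ℝ (Fin n))
    (hHred : ∀ m, Hred m = ContinuousLinearMap.adjoint (A m) ∘L Hess m ∘L A m)
    (w : ℕ → EuclideanSpace ℝ (Fin n))
    (hw : ∀ m, w m = -((Ring.inverse (Hred m + lam m •
        (1 : EuclideanSpace ℝ (Fin n) →L[ℝ] EuclideanSpace ℝ (Fin n)))) (gbar m)))
    (step : ℕ → F) (hstep : ∀ m, step m = A m (w m))
    (Q : ℕ → F → ℝ)
    (hQ : ∀ m (x : F), Q m x = ⟪g m, x⟫ + (1 / 2) * ⟪x, (Hess m) x⟫)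
    (ρ : ℕ → ℝ)
    (hρ : ∀ m, ρ m = (L (f m) - L (f m + step m)) / (Q m 0 - Q m (step m)))
    -- subspace regularity at every stage
    (hAlow : ∀ m, αlow ≤ ‖A m‖) (hAhigh : ∀ m, ‖A m‖ ≤ αhigh)
    (halign : ∀ m, κa * ‖A m‖ * ‖g m‖ ≤ ‖gbar m‖)
    (hcurve : ∀ m, κc * ⟪g m, (Hess m) (g m)⟫ ≤ ⟪step m, (Hess m) (step m)⟫)
    -- update rules
    (hupd : ∀ m,
      (g m ≠ 0 →
        (ρa < ρ m → f (m + 1) = f m + step m) ∧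
        (¬ ρa < ρ m → f (m + 1) = f m) ∧
        (ρ m < ρs → lam (m + 1) = γup * lam m) ∧
        (¬ ρ m < ρs → lam (m + 1) = lam m)) ∧
      (g m = 0 → f (m + 1) = f m ∧ lam (m + 1) = lam m))
    (hρa : ρa = 0) :
    Filter.liminf (fun m => ‖gradient L (f m)‖) Filter.atTop = 0 := by
  subst hρa
  have hα : 0 < αhigh := hαlow.trans_le hαle
  have hHinner (m : ℕ) (v : EuclideanSpace ℝ (Fin n)) :
      ⟪v, Hred m v⟫ = ⟪A m v, Hess m (A m v)⟫ := by
    simp [hHred, ContinuousLinearMap.adjoint_inner_right]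
  have hHnonneg (m : ℕ) (v : EuclideanSpace ℝ (Fin n)) : 0 ≤ ⟪v, Hred m v⟫ := by
    rw [hHinner, hHess]
    exact hHpsd _ _
  have hAle (m : ℕ) (v : EuclideanSpace ℝ (Fin n)) : ‖A m v‖ ≤ αhigh * ‖v‖ :=
    (A m).le_of_opNorm_le (hAhigh m) v
  have hsolve (m : ℕ) (hl : 0 < lam m) : gbar m = -(Hred m (w m) + lam m • w m) := by
    have hu := isUnit_add_smul_one_of_inner_nonneg_s15 (hHnonneg m) hl
    have h1 := congrArg (fun T => T (gbar m)) (Ring.mul_inverse_cancel _ hu)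
    simp only [mul_apply_eq_comp, one_apply_eq_self] at h1
    have h2 : Ring.inverse (Hred m + lam m •
        (1 : EuclideanSpace ℝ (Fin n) →L[ℝ] EuclideanSpace ℝ (Fin n))) (gbar m) = -w m := by
      rw [hw m, neg_neg]
    rw [h2] at h1
    rw [← h1]
    simp [add_comm]
  have hgstep (m : ℕ) (hl : 0 < lam m) :
      ⟪g m, step m⟫ = -(⟪w m, Hred m (w m)⟫ + lam m * ‖w m‖ ^ 2) := by
    rw [hstep, ← ContinuousLinearMap.adjoint_inner_left, ← hgbar, hsolve m hl, inner_neg_left,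
      inner_add_left, real_inner_smul_left, real_inner_self_eq_norm_sq, real_inner_comm]
  have hQdec (m : ℕ) (hl : 0 < lam m) :
      Q m 0 - Q m (step m) = 1 / 2 * ⟪w m, Hred m (w m)⟫ + lam m * ‖w m‖ ^ 2 := by
    rw [hQ, hQ, hgstep m hl, hHinner, ← hstep]
    simp
    ring
  have hgw (m : ℕ) (hl : 0 < lam m) :
      κa * αlow * ‖g m‖ ≤ (αhigh * (β * αhigh) + lam m) * ‖w m‖ := by
    have h1 : ‖gbar m‖ ≤ (αhigh * (β * αhigh) + lam m) * ‖w m‖ := by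
      rw [hsolve m hl, norm_neg, add_mul]
      refine (norm_add_le _ _).trans (add_le_add ?_ ?_)
      · rw [hHred]
        refine ContinuousLinearMap.le_of_opNorm_le _ ?_ _
        refine (ContinuousLinearMap.opNorm_comp_le _ _).trans ?_
        rw [LinearIsometryEquiv.norm_map]
        refine mul_le_mul (hAhigh m) ((ContinuousLinearMap.opNorm_comp_le _ _).trans ?_)
          (norm_nonneg _) hα.le
        exact mul_le_mul ((hHess m).symm ▸ hHnorm _) (hAhigh m) (norm_nonneg _) hβ.le
      · rw [norm_smul, Real.norm_of_nonneg hl.le]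
    refine le_trans ?_ ((halign m).trans h1)
    exact mul_le_mul_of_nonneg_right (mul_le_mul_of_nonneg_left (hAlow m) hκa0.le) (norm_nonneg _)
  have hwpos (m : ℕ) (hl : 0 < lam m) (hgm : g m ≠ 0) : 0 < ‖w m‖ := by
    have h1 : 0 < κa * αlow * ‖g m‖ := by positivity
    have h2 : 0 < αhigh * (β * αhigh) + lam m := by positivity
    exact pos_of_mul_pos_right (h1.trans_le (hgw m hl)) h2.le
  have hQpos (m : ℕ) (hl : 0 < lam m) (hgm : g m ≠ 0) : 0 < Q m 0 - Q m (step m) := by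
    rw [hQdec m hl]
    have := hwpos m hl hgm
    have := hHnonneg m (w m)
    positivity
  obtain ⟨hlow, ⟨M, hM⟩, hev⟩ := bounded_and_eventually_not_of_growth
    (lam := lam) (p := fun m => g m ≠ 0 ∧ ρ m < ρs) (T := β * αhigh ^ 2 / (2 * (1 - ρs)))
    hγup hlamLow hlam0 (fun m hp => ((hupd m).1 hp.1).2.2.1 hp.2)
    (fun m hp => by
      by_cases hgm : g m = 0
      · exact ((hupd m).2 hgm).2
      · exact ((hupd m).1 hgm).2.2.2 fun h => hp ⟨hgm, h⟩)
    (fun m hlm hT hp => by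
      have hl : 0 < lam m := hlamLow.trans_le hlm
      refine hp.2.not_ge ?_
      rw [hρ, le_div_iff₀ (hQpos m hl hp.1), hQdec m hl]
      have h1 := descent_of_norm_fderiv_gradient_le hL hHnorm (f m) (step m)
      rw [← hg, hgstep m hl] at h1
      have h2 : ‖step m‖ ^ 2 ≤ αhigh ^ 2 * ‖w m‖ ^ 2 := by
        rw [← mul_pow, hstep]
        exact pow_le_pow_left₀ (norm_nonneg _) (hAle m _) 2
      rw [div_le_iff₀ (by linarith)] at hT
      have h3 := mul_le_mul_of_nonneg_right hT (sq_nonneg ‖w m‖)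
      have h4 := mul_le_mul_of_nonneg_left h2 hβ.le
      have h5 := mul_nonneg (show 0 ≤ 2 - ρs by linarith) (hHnonneg m (w m))
      nlinarith)
  set K := αhigh * (β * αhigh) + M with hK
  have hKpos : 0 < K := by
    have : 0 < M := hlamLow.trans_le ((hlow 0).trans (hM 0))
    positivity
  have hlim : Tendsto (fun m => ‖g m‖) atTop (nhds 0) := by
    refine tendsto_norm_zero_of_sufficient_decrease (a := fun m => L (f m))
      (c := ρs * (lamLow * (κa * αlow / K) ^ 2)) (by positivity)
      (hbdd.mono (by rintro _ ⟨m, rfl⟩; exact ⟨f m, rfl⟩)) ?_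
    filter_upwards [hev] with m hm
    by_cases hgm : g m = 0
    · simp [hgm, ((hupd m).2 hgm).1]
    have hl : 0 < lam m := hlamLow.trans_le (hlow m)
    have hρm : ρs ≤ ρ m := not_lt.1 fun h => hm ⟨hgm, h⟩
    rw [((hupd m).1 hgm).1 (hρas.trans_le hρm)]
    rw [hρ, le_div_iff₀ (hQpos m hl hgm)] at hρm
    refine le_trans ?_ hρm
    rw [mul_assoc, hQdec m hl]
    refine mul_le_mul_of_nonneg_left ?_ hρas.le
    have h1 : κa * αlow / K * ‖g m‖ ≤ ‖w m‖ := by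
      rw [div_mul_eq_mul_div, div_le_iff₀ hKpos, mul_comm ‖w m‖]
      refine (hgw m hl).trans (mul_le_mul_of_nonneg_right ?_ (norm_nonneg _))
      linarith [hM m]
    have h2 := pow_le_pow_left₀ (by positivity) h1 2
    rw [mul_pow] at h2
    have h3 := mul_le_mul (hlow m) h2 (by positivity) hl.le
    linarith [hHnonneg m (w m)]
  simpa only [hg] using hlim.liminf_eq
end

section
/- (VPBoost superlinear rate of convergence.) Let F be a real Hilbert space and L : F → ℝ twice continuously Fréchet differentiable. Let f* ∈ F satisfy ∇L(f*) = 0, suppose there exists μ > 0 with ⟨h, ∇²L(f*)h⟩ ≥ μ‖h‖² for all h ∈ F, and suppose ∇²L is Lipschitz continuous on a neighborhood of f*. Let (f_m) be a sequence converging to f* with f_m ≠ f* for all m, and define, for m large enough that ∇²L(f_m) is invertible, the Newton step h_N(f_m) = -(∇²L(f_m))⁻¹∇L(f_m) (nonzero for f_m ≠ f* near f*). If the steps h_m satisfy f_{m+1} = f_m + h_m and are asymptotically similar to the Newton steps, i.e., ‖h_m - h_N(f_m)‖ / ‖h_N(f_m)‖ → 0 as m → ∞, then the iterates converge superlinearly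 to f*: ‖f_{m+1} - f*‖ / ‖f_m - f*‖ → 0 as m → ∞. -/
open scoped RealInnerProductSpace

open Asymptotics Filter Topology

/-- The gradient of a `C^(n+1)` function on a real Hilbert space is `C^n`. -/
theorem ContDiff.gradient_of_succ {F : Type*} [NormedAddCommGroup F] [InnerProductSpace ℝ F]
    [CompleteSpace F] {L : F → ℝ} {n : ℕ} (hL : ContDiff ℝ (n + 1) L) :
    ContDiff ℝ n (gradient L) :=
  (InnerProductSpace.toDual ℝ F).symm.contDiff.comp (hL.fderiv_right le_rfl)

/-- A bounded operator whose quadratic form is bounded below by `μ‖h‖²` is invertible. -/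
theorem ContinuousLinearMap.isUnit_of_forall_le_inner {F : Type*} [NormedAddCommGroup F]
    [InnerProductSpace ℝ F] [CompleteSpace F] (A : F →L[ℝ] F) {μ : ℝ} (hμ : 0 < μ)
    (hA : ∀ h : F, μ * ‖h‖ ^ 2 ≤ ⟪h, A h⟫) : IsUnit A := by
  have hB : IsCoercive ((innerSL ℝ).comp A) := by
    refine ⟨μ, hμ, fun u => ?_⟩
    have h := hA u
    rw [real_inner_comm] at h
    simpa [pow_two, mul_assoc] using h
  have hAe : (hB.continuousLinearEquivOfBilin : F →L[ℝ] F) = A := by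
    ext v
    refine ext_inner_right ℝ fun w => ?_
    simp
  rw [← hAe]
  exact ((ContinuousLinearEquiv.unitsEquiv ℝ F).symm hB.continuousLinearEquivOfBilin).isUnit

/-- Near a zero `a` of a `C^1` map `G` with invertible derivative, the Newton step at `x` agrees
with `a - x` to first order. -/
theorem newton_step_add_sub_isLittleO {E : Type*} [NormedAddCommGroup E] [NormedSpace ℝ E]
    [CompleteSpace E] {G : E → E} (hG : ContDiff ℝ 1 G) {a : E} (ha : G a = 0)
    (hunit : IsUnit (fderiv ℝ G a)) :
    (fun x => -(Ring.inverse (fderiv ℝ G x) (G x)) + (x - a)) =o[𝓝 a] fun x => x - a := by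
  have hcont : ContinuousAt (fderiv ℝ G) a := (hG.continuous_fderiv one_ne_zero).continuousAt
  have hinv : ContinuousAt (fun x => Ring.inverse (fderiv ℝ G x)) a := by
    obtain ⟨u, hu⟩ := hunit
    have h := NormedRing.inverse_continuousAt u
    rw [hu] at h
    exact ContinuousAt.comp (f := fderiv ℝ G) h hcont
  have htaylor : (fun x => G x - fderiv ℝ G a (x - a)) =o[𝓝 a] fun x => x - a := by
    simpa [ha] using ((hG.differentiable one_ne_zero) a).hasFDerivAt.isLittleO
  have hderiv : (fun x => (fderiv ℝ G x - fderiv ℝ G a) (x - a)) =o[𝓝 a] fun x => x - a := by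
    have h0 : (fun x => fderiv ℝ G x - fderiv ℝ G a) =o[𝓝 a] fun _ => (1 : ℝ) := by
      rw [isLittleO_one_iff]
      simpa using hcont.tendsto.sub_const (fderiv ℝ G a)
    have h1 := h0.norm_left.mul_isBigO (isBigO_refl (fun x => ‖x - a‖) (𝓝 a))
    simp only [one_mul] at h1
    exact (IsBigO.of_norm_le fun x => (fderiv ℝ G x - fderiv ℝ G a).le_opNorm _).trans_isLittleO
      h1.of_norm_right
  have hresid : (fun x => fderiv ℝ G x (x - a) - G x) =o[𝓝 a] fun x => x - a :=
    (hderiv.sub htaylor).congr_left fun x => by simp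
  have happly : (fun x => Ring.inverse (fderiv ℝ G x) (fderiv ℝ G x (x - a) - G x))
      =o[𝓝 a] fun x => x - a := by
    have h0 : (fun x => Ring.inverse (fderiv ℝ G x)) =O[𝓝 a] fun _ => (1 : ℝ) :=
      hinv.tendsto.isBigO_one ℝ
    have h1 := h0.norm_left.mul_isLittleO hresid.norm_norm
    simp only [one_mul] at h1
    exact (IsBigO.of_norm_le fun x =>
      (Ring.inverse (fderiv ℝ G x)).le_opNorm _).trans_isLittleO h1.of_norm_right
  have hunits : ∀ᶠ x in 𝓝 a, IsUnit (fderiv ℝ G x) :=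
    hcont.eventually (Units.isOpen.mem_nhds hunit)
  refine happly.congr' ?_ EventuallyEq.rfl
  filter_upwards [hunits] with x hx
  have h : Ring.inverse (fderiv ℝ G x) (fderiv ℝ G x (x - a)) = x - a := by
    rw [← mul_apply_eq_comp, Ring.inverse_mul_cancel _ hx,
      one_apply_eq_self]
  rw [map_sub, h]
  abel

/-- **VPBoost superlinear rate of convergence.** Let `L` be twice continuously
Fréchet differentiable on a real Hilbert space, `f*` a stationary point whose Hessian is
uniformly positive definite (`⟨h, ∇²L(f*)h⟩ ≥ μ‖h‖²`), with `∇²L` Lipschitz on a neighborhood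
of `f*`.  If the iterates `f_{m+1} = f_m + h_m` converge to `f*` with `f_m ≠ f*`, and the
steps `h_m` are asymptotically similar to the Newton steps
`h_N(f_m) = -(∇²L(f_m))⁻¹∇L(f_m)` (i.e. `‖h_m - h_N(f_m)‖/‖h_N(f_m)‖ → 0`), then the
iterates converge superlinearly: `‖f_{m+1} - f*‖/‖f_m - f*‖ → 0`. -/
theorem stmt18 {F : Type*} [NormedAddCommGroup F] [InnerProductSpace ℝ F] [CompleteSpace F]
    (L : F → ℝ) (hL : ContDiff ℝ 2 L)
    (fstar : F) (hstat : gradient L fstar = 0)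
    (μ : ℝ) (hμ : 0 < μ)
    (hpd : ∀ h : F, μ * ‖h‖ ^ 2 ≤ ⟪h, (fderiv ℝ (gradient L) fstar) h⟫)
    (hlipHess : ∃ ε > (0 : ℝ), ∃ C : ℝ, ∀ x y : F,
      ‖x - fstar‖ < ε → ‖y - fstar‖ < ε →
      ‖fderiv ℝ (gradient L) x - fderiv ℝ (gradient L) y‖ ≤ C * ‖x - y‖)
    (f : ℕ → F) (hconv : Filter.Tendsto f Filter.atTop (nhds fstar))
    (hne : ∀ m, f m ≠ fstar)
    (step : ℕ → F) (hstep : ∀ m, f (m + 1) = f m + step m)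
    (hsim : Filter.Tendsto (fun m =>
        ‖step m - (-((Ring.inverse (fderiv ℝ (gradient L) (f m)))
            (gradient L (f m))))‖ /
          ‖-((Ring.inverse (fderiv ℝ (gradient L) (f m))) (gradient L (f m)))‖)
      Filter.atTop (nhds 0)) :
    Filter.Tendsto (fun m => ‖f (m + 1) - fstar‖ / ‖f m - fstar‖)
      Filter.atTop (nhds 0) := by
  have hG : ContDiff ℝ 1 (gradient L) := by
    exact_mod_cast ContDiff.gradient_of_succ (n := 1) (by simpa [one_add_one_eq_two] using hL)
  have hunit := ContinuousLinearMap.isUnit_of_forall_le_inner _ hμ hpd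
  set N : ℕ → F := fun m => -(Ring.inverse (fderiv ℝ (gradient L) (f m)) (gradient L (f m)))
  have hN : (fun m => N m + (f m - fstar)) =o[atTop] fun m => f m - fstar :=
    (newton_step_add_sub_isLittleO hG hstat hunit).comp_tendsto hconv
  have hNO : N =O[atTop] fun m => f m - fstar :=
    (hN.isBigO.sub (isBigO_refl _ _)).congr_left fun m => by simp
  have hN0 : ∀ᶠ m in atTop, N m ≠ 0 := by
    filter_upwards [hN.bound (half_pos one_pos)] with m hm h0
    have hpos : 0 < ‖f m - fstar‖ := norm_pos_iff.2 (sub_ne_zero.2 (hne m))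
    rw [h0, zero_add] at hm
    linarith
  have hstepN : (fun m => step m - N m) =o[atTop] N := by
    refine IsLittleO.of_norm_norm ((isLittleO_iff_tendsto' ?_).2 hsim)
    filter_upwards [hN0] with m hm h
    exact absurd (norm_eq_zero.1 h) hm
  have hmain : (fun m => f (m + 1) - fstar) =o[atTop] fun m => f m - fstar :=
    ((hstepN.trans_isBigO hNO).add hN).congr_left fun m => by
      rw [hstep]
      abel
  exact hmain.norm_norm.tendsto_div_nhds_zero
end
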